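/- Let A be an infinite-dimensional Banach algebra. Then the set of maximal elements of the family of non-finitely-generated left ideals of A equals the set of maximal elements of the family of non-countably-generated left ideals of A, this common family is non-empty, and each of its members is a closed left ideal. -/

import Mathlib

noncomputable section

/-- A left ideal of an algebra `A`, encoded as a `ℂ`-submodule closed under
left multiplication by arbitrary elements of `A`. -/
def IsLeftIdeal {A : Type*} [NonUnitalNonAssocSemiring A] [Module ℂ A]
    (I : Submodule ℂ A) : Prop :=
  ∀ a : A, ∀ x ∈ I, a * x ∈ I

/-- The left ideal generated by a set `S` (equivalently `⟨S⟩ = A♯·S`). -/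
def leftIdealGen {A : Type*} [NonUnitalNonAssocSemiring A] [Module ℂ A]
    (S : Set A) : Submodule ℂ A :=
  sInf {I : Submodule ℂ A | IsLeftIdeal I ∧ S ⊆ ↑I}

/-- A left ideal is finitely generated if it is generated by a finite subset of itself. -/
def IsFGLeftIdeal {A : Type*} [NonUnitalNonAssocSemiring A] [Module ℂ A]
    (I : Submodule ℂ A) : Prop :=
  ∃ S : Finset A, ↑S ⊆ (I : Set A) ∧ leftIdealGen (↑S : Set A) = I

/-- A left ideal is countably generated if it is generated by a countable subset of itself. -/
def IsCGLeftIdeal {A : Type*} [NonUnitalNonAssocSemiring A] [Module ℂ A]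
    (I : Submodule ℂ A) : Prop :=
  ∃ S : Set A, S.Countable ∧ S ⊆ (I : Set A) ∧ leftIdealGen S = I

/-- Membership in `𝔐∞(A)`: a maximal element of the family of
non-finitely-generated left ideals. -/
def IsMaxNonFG {A : Type*} [NonUnitalNonAssocSemiring A] [Module ℂ A]
    (M : Submodule ℂ A) : Prop :=
  IsLeftIdeal M ∧ ¬ IsFGLeftIdeal M ∧
    ∀ J : Submodule ℂ A, IsLeftIdeal J → ¬ IsFGLeftIdeal J → M ≤ J → J = M

/-- Membership in `𝔑∞(A)`: a maximal element of the family of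
non-countably-generated left ideals. -/
def IsMaxNonCG {A : Type*} [NonUnitalNonAssocSemiring A] [Module ℂ A]
    (M : Submodule ℂ A) : Prop :=
  IsLeftIdeal M ∧ ¬ IsCGLeftIdeal M ∧
    ∀ J : Submodule ℂ A, IsLeftIdeal J → ¬ IsCGLeftIdeal J → M ≤ J → J = M

/-- `M` is a maximal left ideal. -/
def IsMaxLeftIdeal {A : Type*} [NonUnitalNonAssocSemiring A] [Module ℂ A]
    (M : Submodule ℂ A) : Prop :=
  IsLeftIdeal M ∧ M ≠ ⊤ ∧ ∀ J : Submodule ℂ A, IsLeftIdeal J → M < J → J = ⊤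


set_option maxHeartbeats 1000000 in
open Polynomial in
/-- In a corner `eCe` with only trivial idempotents, an algebraic element is scalar plus
nilpotent. -/
lemma prim_scalar_add_nilp {R : Type*} [Ring R] [Algebra ℂ R] (e : R) (he0 : e ≠ 0)
    (he : e * e = e)
    (hprim : ∀ f : R, f * f = f → e * f = f → f * e = f → f = 0 ∨ f = e)
    (x : R) (hex : e * x = x) (hxe : x * e = x) :
    ∀ (n : ℕ) (p : ℂ[X]), p.natDegree = n → p ≠ 0 → aeval x p * e = 0 →
      ∃ l : ℂ, IsNilpotent (x - l • e) := by
  intro n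
  induction n using Nat.strong_induction_on with
  | _ n ih =>
  intro p hpn hp0 hpx
  have hcomm : ∀ q : ℂ[X], aeval x q * e = e * aeval x q := by
    intro q
    have hc : Commute e x := by unfold Commute SemiconjBy; rw [hex, hxe]
    induction q using Polynomial.induction_on' with
    | add p q hp hq => simp [add_mul, mul_add, hp, hq]
    | monomial n a =>
      rw [aeval_monomial]
      exact (((Algebra.commute_algebraMap_left a e)).mul_left ((hc.symm.pow_left n))).eq
  have hdeg : p.degree ≠ 0 := by
    intro h
    rw [eq_C_of_degree_eq_zero h] at hpx hp0
    rw [aeval_C, Algebra.algebraMap_eq_smul_one, smul_mul_assoc, one_mul] at hpx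
    have : p.coeff 0 ≠ 0 := by intro h'; apply hp0; simp [h']
    exact (smul_ne_zero this he0) hpx
  obtain ⟨l, hl⟩ := IsAlgClosed.exists_root p hdeg
  obtain ⟨r, hr, hndvd⟩ := exists_eq_pow_rootMultiplicity_mul_and_not_dvd p hp0 l
  have hm : 0 < p.rootMultiplicity l := (rootMultiplicity_pos hp0).2 hl
  set m := p.rootMultiplicity l
  have hcop : IsCoprime ((X - C l) ^ m) r := by
    apply IsCoprime.pow_left
    exact (irreducible_X_sub_C l).coprime_iff_not_dvd.2 hndvd
  obtain ⟨v, u, huv⟩ := hcop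
  set f := aeval x (u * r) * e with hf
  have hr0 : r ≠ 0 := by rintro rfl; simp at hr; exact hp0 hr
  have key : ∀ q s : ℂ[X], (aeval x q * e) * (aeval x s * e) = aeval x (q * s) * e := by
    intro q s
    rw [map_mul, mul_assoc, ← mul_assoc e, ← hcomm s, mul_assoc _ e e, he, mul_assoc]
  have hmul : ∀ q : ℂ[X], aeval x (q * p) * e = 0 := by
    intro q; rw [← key, hpx, mul_zero]
  have hff : f * f = f := by
    rw [hf, key]
    have : (u * r) * (u * r) = u * r - (u * v) * p := by
      have h1 : u * r = 1 - v * (X - C l) ^ m := by rw [← huv]; ring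
      calc (u * r) * (u * r) = (u * r) * (1 - v * (X - C l) ^ m) := by rw [← h1]
        _ = u * r - (u * v) * ((X - C l) ^ m * r) := by ring
        _ = _ := by rw [← hr]
    rw [this, map_sub, sub_mul, hmul, sub_zero]
  rcases hprim f hff (by rw [hf, ← mul_assoc, ← hcomm, mul_assoc, he])
    (by rw [hf, mul_assoc, he]) with h | h
  · have hlt : r.natDegree < n := by
      rw [← hpn, hr, natDegree_mul (pow_ne_zero _ (X_sub_C_ne_zero l)) hr0]
      simp; omega
    refine ih _ hlt r rfl hr0 ?_
    have : r = v * p + r * (u * r) := by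
      calc r = r * (v * (X - C l) ^ m + u * r) := by rw [huv, mul_one]
        _ = v * ((X - C l) ^ m * r) + r * (u * r) := by ring
        _ = _ := by rw [← hr]
    rw [this, map_add, add_mul, hmul, zero_add, ← key, ← hf, h, mul_zero]
  · refine ⟨l, m, ?_⟩
    have h1 : x - l • e = aeval x (X - C l) * e := by
      simp [sub_mul, hxe, Algebra.algebraMap_eq_smul_one]
    have h2 : ∀ k : ℕ, 0 < k → (aeval x (X - C l) * e) ^ k = aeval x ((X - C l) ^ k) * e := by
      intro k hk
      induction k, hk using Nat.le_induction with
      | base => simp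
      | succ k hk ih => rw [pow_succ, ih, key, ← pow_succ]
    rw [h1, h2 m hm]
    calc aeval x ((X - C l) ^ m) * e = (aeval x ((X - C l) ^ m) * e) * f := by
          rw [h, mul_assoc, he]
      _ = aeval x (u * p) * e := by
          rw [hf, key]; congr 2
          conv_rhs => rw [hr]
          ring
      _ = 0 := hmul u

/-- Primitive idempotents. -/
def IsPrimIdem {C : Type*} [Ring C] (e : C) : Prop :=
  e ≠ 0 ∧ e * e = e ∧ ∀ f : C, f * f = f → e * f = f → f * e = f → f = 0 ∨ f = e

/-- Left annihilator of an element. -/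
def leftAnn {C : Type*} [Ring C] (a : C) : Ideal C :=
  LinearMap.ker (LinearMap.toSpanSingleton C C a)

lemma mem_leftAnn {C : Type*} [Ring C] (a x : C) : x ∈ leftAnn a ↔ x * a = 0 := by
  simp [leftAnn]

/-- A corner at a primitive idempotent in a semiprime left Noetherian algebraic algebra. -/
lemma corner_scalar {C : Type*} [Ring C] [Algebra ℂ C] [IsNoetherianRing C]
    (halg : ∀ x : C, IsAlgebraic ℂ x)
    (hsemi : ∀ x : C, (∀ u, x * u * x = 0) → x = 0)
    {e : C} (hprim : IsPrimIdem e) (x : C) (hex : e * x = x) (hxe : x * e = x) :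
    ∃ l : ℂ, x = l • e := by
  obtain ⟨he0, he, hpr⟩ := hprim
  have hdec : ∀ x : C, e * x = x → x * e = x → ∃ l : ℂ, IsNilpotent (x - l • e) := by
    intro x h1 h2
    obtain ⟨p, hp, hpx⟩ := halg x
    exact prim_scalar_add_nilp e he0 he hpr x h1 h2 _ p rfl hp (by rw [hpx, zero_mul])
  -- nilpotents in the corner absorb multiplication
  have habs : ∀ a u : C, e * a = a → a * e = a → e * u = u → u * e = u → IsNilpotent a →
      IsNilpotent (a * u) := by
    intro a u ha1 ha2 hu1 hu2 ha
    obtain ⟨l, hl⟩ := hdec (a * u) (by rw [← mul_assoc, ha1]) (by rw [mul_assoc, hu2])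
    by_cases hl0 : l = 0
    · simpa [hl0] using hl
    exfalso
    -- `a * u = l e + n` is invertible in the corner
    set n := a * u - l • e with hn
    have hen : e * n = n := by
      rw [hn, mul_sub, ← mul_assoc, ha1, mul_smul_comm, he]
    have hne : n * e = n := by
      rw [hn, sub_mul, mul_assoc, hu2, smul_mul_assoc, he]
    have hunit : IsUnit (algebraMap ℂ C l + n) := by
      have : IsUnit (algebraMap ℂ C l) := (IsUnit.mk0 l hl0).map _
      exact IsNilpotent.isUnit_add_left_of_commute hl this (Algebra.commute_algebraMap_right l n)
    obtain ⟨w, hw⟩ := hunit.exists_right_inv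
    have hau : a * (u * w) = e := by
      have h3 : a * u = e * (algebraMap ℂ C l + n) := by
        rw [mul_add, hen, Algebra.algebraMap_eq_smul_one, mul_smul_comm, mul_one, hn]; abel
      rw [← mul_assoc, h3, mul_assoc, hw, mul_one]
    obtain ⟨k, hk⟩ := ha
    have : ∀ k : ℕ, a ^ k * e ≠ 0 := by
      intro k
      induction k with
      | zero => simpa using he0
      | succ k ih =>
        intro h
        apply ih
        rw [pow_succ, mul_assoc, ha2] at h
        rw [← hau, ← mul_assoc, h, zero_mul]
    exact this k (by rw [hk, zero_mul])
  -- no nonzero nilpotents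
  have hnil : ∀ a : C, e * a = a → a * e = a → IsNilpotent a → a = 0 := by
    by_contra hcon
    push Not at hcon
    obtain ⟨a0, h1, h2, h3, h4⟩ := hcon
    let S : Set (Ideal C) := leftAnn '' {a | e * a = a ∧ a * e = a ∧ IsNilpotent a ∧ a ≠ 0}
    have hS : S.Nonempty := ⟨_, a0, ⟨h1, h2, h3, h4⟩, rfl⟩
    obtain ⟨_, ⟨a, ⟨ha1, ha2, ha3, ha4⟩, rfl⟩, hmax⟩ := set_has_maximal_iff_noetherian.2
      (inferInstanceAs (IsNoetherian C C)) S hS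
    have hae : ∀ u : C, e * u = u → u * e = u → a * u * a = 0 := by
      intro u hu1 hu2
      by_cases hau : a * u = 0
      · rw [hau, zero_mul]
      have hnl := habs a u ha1 ha2 hu1 hu2 ha3
      obtain ⟨k, hk1, hk2⟩ : ∃ k : ℕ, (a * u) ^ (k + 1) ≠ 0 ∧ (a * u) ^ (k + 2) = 0 := by
        classical
        have hf := Nat.find_spec hnl
        have h0 : Nat.find hnl ≠ 0 := by
          intro h; rw [h, pow_zero] at hf
          exact hau (by rw [← mul_one (a * u), hf, mul_zero])
        have h1 : Nat.find hnl ≠ 1 := by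
          intro h; rw [h, pow_one] at hf
          exact hau hf
        refine ⟨Nat.find hnl - 2, ?_, ?_⟩
        · exact Nat.find_min hnl (by omega)
        · convert hf using 2; omega
      have hb : leftAnn ((a * u) ^ (k + 1)) ∈ S := by
        refine ⟨_, ⟨?_, ?_, ?_, hk1⟩, rfl⟩
        · rw [pow_succ', ← mul_assoc, ← mul_assoc, ha1]
        · rw [pow_succ, mul_assoc, mul_assoc, hu2]
        · exact hnl.pow_of_pos (by omega)
      have hle : leftAnn a ≤ leftAnn ((a * u) ^ (k + 1)) := by
        intro y hy
        rw [mem_leftAnn] at hy ⊢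
        rw [pow_succ', ← mul_assoc, ← mul_assoc, hy]; simp
      have heq : leftAnn a = leftAnn ((a * u) ^ (k + 1)) := by
        by_contra hne
        exact hmax _ hb (lt_of_le_of_ne hle hne)
      have : a * u ∈ leftAnn a := by
        rw [heq, mem_leftAnn, ← pow_succ', hk2]
      rwa [mem_leftAnn] at this
    apply ha4
    apply hsemi
    intro u
    have := hae (e * u * e) (by rw [← mul_assoc, ← mul_assoc, he]) (by rw [mul_assoc, he])
    calc a * u * a = (a * e) * u * (e * a) := by rw [ha1, ha2]
      _ = a * (e * u * e) * a := by noncomm_ring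
      _ = 0 := this
  obtain ⟨l, hl⟩ := hdec x hex hxe
  refine ⟨l, sub_eq_zero.1 (hnil _ ?_ ?_ hl)⟩
  · rw [mul_sub, hex, mul_smul_comm, he]
  · rw [sub_mul, hxe, smul_mul_assoc, he]

/-- In a left Noetherian ring every idempotent is a sum of primitive idempotents. -/
lemma idem_mem_closure {C : Type*} [Ring C] [IsNoetherianRing C] :
    ∀ (I : Ideal C) (e : C), e * e = e → leftAnn e = I →
      e ∈ AddSubmonoid.closure {f : C | IsPrimIdem f} := by
  intro I
  induction I using WellFoundedGT.induction with
  | ind I ih =>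
  intro e he hI
  by_cases h0 : e = 0
  · rw [h0]; exact zero_mem _
  by_cases hp : IsPrimIdem e
  · exact AddSubmonoid.subset_closure hp
  unfold IsPrimIdem at hp
  push Not at hp
  obtain ⟨f, hf, hef, hfe, hf0, hfne⟩ := hp h0 he
  -- general step
  have step : ∀ f : C, f * f = f → e * f = f → f * e = f → f ≠ e →
      f ∈ AddSubmonoid.closure {f : C | IsPrimIdem f} := by
    intro f hf hef hfe hfne
    refine ih (leftAnn f) ?_ f hf rfl
    rw [← hI]
    refine lt_of_le_of_ne ?_ ?_
    · intro y hy
      rw [mem_leftAnn] at hy ⊢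
      rw [← hef, ← mul_assoc, hy, zero_mul]
    · intro h
      have : (1 - f) ∈ leftAnn e := by
        rw [h, mem_leftAnn, sub_mul, one_mul, hf, sub_self]
      rw [mem_leftAnn, sub_mul, one_mul, hfe, sub_eq_zero] at this
      exact hfne this.symm
  have : e = f + (e - f) := by abel
  rw [this]
  refine add_mem (step f hf hef hfe hfne) (step (e - f) ?_ ?_ ?_ ?_)
  · rw [mul_sub, sub_mul, sub_mul, he, hfe, hef, hf]; abel
  · rw [mul_sub, he, hef]
  · rw [sub_mul, he, hfe]
  · intro h; exact hf0 (sub_eq_self.1 h)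

/-- The linear map `c ↦ a c b`. -/
def sandwich {C : Type*} [Ring C] [Algebra ℂ C] (a b : C) : C →ₗ[ℂ] C :=
  LinearMap.mulLeft ℂ a ∘ₗ LinearMap.mulRight ℂ b

lemma sandwich_apply {C : Type*} [Ring C] [Algebra ℂ C] (a b c : C) :
    sandwich a b c = a * (c * b) := rfl

lemma finite_of_semiprime {C : Type*} [Ring C] [Algebra ℂ C] [IsNoetherianRing C]
    (halg : ∀ x : C, IsAlgebraic ℂ x)
    (hsemi : ∀ x : C, (∀ u, x * u * x = 0) → x = 0) : FiniteDimensional ℂ C := by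
  have hone : (1 : C) ∈ AddSubmonoid.closure {f : C | IsPrimIdem f} :=
    idem_mem_closure _ 1 (by simp) rfl
  have hsw : ∀ e f : C, IsPrimIdem e → IsPrimIdem f →
      (LinearMap.range (sandwich e f)).FG := by
    intro e f he hf
    by_cases hz : ∀ c, e * (c * f) = 0
    · have : sandwich e f = 0 := by ext c; exact hz c
      rw [this, LinearMap.range_zero]; exact Submodule.fg_bot
    push Not at hz
    obtain ⟨c, hc⟩ := hz
    set x := e * (c * f) with hx
    have hex : e * x = x := by rw [hx, ← mul_assoc, he.2.1]
    have hxf : x * f = x := by rw [hx, mul_assoc, mul_assoc, hf.2.1]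
    obtain ⟨u, hu⟩ : ∃ u, x * u * x ≠ 0 := by
      by_contra h; push Not at h; exact hc (hsemi x h)
    obtain ⟨l, hl⟩ := corner_scalar halg hsemi he (x * u * e)
      (by rw [← mul_assoc, ← mul_assoc, hex]) (by rw [mul_assoc, he.2.1])
    have hl0 : l ≠ 0 := by
      rintro rfl
      apply hu
      rw [zero_smul] at hl
      calc x * u * x = x * u * (e * x) := by rw [hex]
        _ = (x * u * e) * x := by noncomm_ring
        _ = 0 := by rw [hl]; simp
    refine Submodule.FG.of_le (T := Submodule.span ℂ {x}) (Submodule.fg_span_singleton x) ?_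
    rintro _ ⟨d, rfl⟩
    rw [sandwich_apply, Submodule.mem_span_singleton]
    obtain ⟨m, hm⟩ := corner_scalar halg hsemi hf (f * (u * e * d) * f)
      (by rw [← mul_assoc, ← mul_assoc, hf.2.1]) (by rw [mul_assoc, hf.2.1])
    refine ⟨l⁻¹ * m, ?_⟩
    have h1 : l • (e * (d * f)) = m • x := by
      calc l • (e * (d * f)) = (l • e) * (d * f) := by rw [smul_mul_assoc]
        _ = (x * f) * u * e * (d * f) := by rw [hxf, hl]
        _ = x * (f * (u * e * d) * f) := by noncomm_ring
        _ = m • x := by rw [hm, mul_smul_comm, hxf]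
    rw [mul_smul, ← h1, smul_smul, inv_mul_cancel₀ hl0, one_smul]
  have hadd1 : ∀ a a' b : C, (LinearMap.range (sandwich a b)).FG →
      (LinearMap.range (sandwich a' b)).FG → (LinearMap.range (sandwich (a + a') b)).FG := by
    intro a a' b h h'
    refine Submodule.FG.of_le (h.sup h') ?_
    rintro _ ⟨d, rfl⟩
    rw [sandwich_apply, add_mul]
    exact Submodule.add_mem_sup ⟨d, rfl⟩ ⟨d, rfl⟩
  have hadd2 : ∀ a b b' : C, (LinearMap.range (sandwich a b)).FG →
      (LinearMap.range (sandwich a b')).FG → (LinearMap.range (sandwich a (b + b'))).FG := by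
    intro a b b' h h'
    refine Submodule.FG.of_le (h.sup h') ?_
    rintro _ ⟨d, rfl⟩
    rw [sandwich_apply, mul_add, mul_add]
    exact Submodule.add_mem_sup ⟨d, rfl⟩ ⟨d, rfl⟩
  have hz1 : ∀ b : C, (LinearMap.range (sandwich 0 b)).FG := by
    intro b
    have : sandwich 0 b = 0 := by ext c; simp [sandwich_apply]
    rw [this, LinearMap.range_zero]; exact Submodule.fg_bot
  have hz2 : ∀ b : C, (LinearMap.range (sandwich b 0)).FG := by
    intro b
    have : sandwich b 0 = 0 := by ext c; simp [sandwich_apply]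
    rw [this, LinearMap.range_zero]; exact Submodule.fg_bot
  have hall : (LinearMap.range (sandwich (1 : C) 1)).FG := by
    have : ∀ e, IsPrimIdem e → (LinearMap.range (sandwich (1 : C) e)).FG := by
      intro e he
      generalize (1 : C) = z at hone
      induction hone using AddSubmonoid.closure_induction with
      | mem x hx => exact hsw x e hx he
      | zero => exact hz1 e
      | add x y _ _ hx hy => exact hadd1 x y e hx hy
    have h2 : ∀ z ∈ AddSubmonoid.closure {f : C | IsPrimIdem f},
        (LinearMap.range (sandwich (1 : C) z)).FG := by
      intro z hz
      induction hz using AddSubmonoid.closure_induction with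
      | mem x hx => exact this x hx
      | zero => exact hz2 1
      | add x y _ _ hx hy => exact hadd2 1 x y hx hy
    exact h2 1 hone
  have htop : LinearMap.range (sandwich (1 : C) 1) = ⊤ := by
    rw [LinearMap.range_eq_top]; intro c; exact ⟨c, by simp [sandwich_apply]⟩
  rw [htop] at hall
  exact ⟨hall⟩

/-- If every proper quotient by a nonzero two-sided ideal is finite-dimensional, so is `C`. -/
lemma finite_of_proper_quot {C : Type*} [Ring C] [Algebra ℂ C] [IsNoetherianRing C]
    (halg : ∀ x : C, IsAlgebraic ℂ x)
    (hq : ∀ K : Ideal C, K.IsTwoSided → K ≠ ⊥ → FiniteDimensional ℂ (C ⧸ K)) :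
    FiniteDimensional ℂ C := by
  by_cases hsemi : ∀ x : C, (∀ u, x * u * x = 0) → x = 0
  · exact finite_of_semiprime halg hsemi
  push Not at hsemi
  obtain ⟨x, hx, hx0⟩ := hsemi
  let K : Ideal C := Ideal.span (Set.range fun u => x * u)
  have hK2 : K.IsTwoSided := by
    constructor
    intro a b ha
    refine Submodule.span_induction (p := fun a _ => a * b ∈ K) ?_ ?_ ?_ ?_ ha
    · rintro _ ⟨u, rfl⟩
      exact Ideal.subset_span ⟨u * b, by simp [mul_assoc]⟩
    · simp
    · intro y z _ _ hy hz; rw [add_mul]; exact add_mem hy hz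
    · intro c y _ hy; rw [smul_eq_mul, mul_assoc]; exact K.mul_mem_left c hy
  have hxK : x ∈ K := Ideal.subset_span ⟨1, by simp⟩
  have hKK : ∀ a ∈ K, ∀ b ∈ K, a * b = 0 := by
    intro a ha b hb
    refine Submodule.span_induction (p := fun a _ => a * b = 0) ?_ ?_ ?_ ?_ ha
    · rintro _ ⟨u, rfl⟩
      have : ∀ w, x * w * b = 0 := by
        refine Submodule.span_induction (p := fun b _ => ∀ w, x * w * b = 0) ?_ ?_ ?_ ?_ hb
        · rintro _ ⟨v, rfl⟩ w
          simp only
          rw [← mul_assoc, hx, zero_mul]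
        · simp
        · intro y z _ _ hy hz w; rw [mul_add, hy, hz, add_zero]
        · intro c y _ hy w; rw [smul_eq_mul, ← mul_assoc, mul_assoc x, hy]
      exact this u
    · simp
    · intro y z _ _ hy hz; rw [add_mul, hy, hz, add_zero]
    · intro c y _ hy; rw [smul_eq_mul, mul_assoc, hy, mul_zero]
  have hfin := hq K hK2 (fun h => hx0 (by rw [h] at hxK; simpa using hxK))
  obtain ⟨s, hs⟩ := IsNoetherian.noetherian K
  -- the K-part is finite-dimensional
  have hFG : (K.restrictScalars ℂ).FG := by
    have h1 : ∀ k ∈ K, (LinearMap.range (LinearMap.mulRight ℂ k)).FG := by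
      intro k hk
      have hle : K.restrictScalars ℂ ≤ LinearMap.ker (LinearMap.mulRight ℂ k) := by
        intro a ha; exact hKK a ha k hk
      have h2 := Submodule.range_liftQ (K.restrictScalars ℂ) (LinearMap.mulRight ℂ k) hle
      rw [← h2]
      have : FiniteDimensional ℂ (C ⧸ K.restrictScalars ℂ) := hfin
      exact Module.Finite.iff_fg.1 inferInstance
    have hsK : ∀ k ∈ s, k ∈ K := fun k hk => by rw [← hs]; exact Submodule.subset_span hk
    refine Submodule.FG.of_le (T := ⨆ k ∈ s, LinearMap.range (LinearMap.mulRight ℂ k)) ?_ ?_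
    · exact Submodule.fg_biSup s _ fun k hk => h1 k (hsK k hk)
    · intro a ha
      have ha' : a ∈ K := ha
      rw [← hs] at ha'
      refine Submodule.span_induction (p := fun a _ => a ∈ ⨆ k ∈ s,
        LinearMap.range (LinearMap.mulRight ℂ k)) ?_ ?_ ?_ ?_ ha'
      · intro k hk
        exact (le_iSup₂_of_le k hk le_rfl : LinearMap.range (LinearMap.mulRight ℂ k) ≤ _)
          ⟨1, by simp⟩
      · simp
      · intro y z _ _ hy hz; exact add_mem hy hz
      · intro c y _ hy
        rw [smul_eq_mul]
        have : (⨆ k ∈ s, LinearMap.range (LinearMap.mulRight ℂ k)) ≤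
          (⨆ k ∈ s, LinearMap.range (LinearMap.mulRight ℂ k)).comap (LinearMap.mulLeft ℂ c) := by
          refine iSup₂_le fun k hk => ?_
          rintro _ ⟨d, rfl⟩
          refine (le_iSup₂_of_le k hk le_rfl : LinearMap.range (LinearMap.mulRight ℂ k) ≤ _) ?_
          exact ⟨c * d, by simp [mul_assoc]⟩
        exact this hy
  have i1 : FiniteDimensional ℂ (K.restrictScalars ℂ) := Module.Finite.iff_fg.2 hFG
  have i2 : FiniteDimensional ℂ (C ⧸ K.restrictScalars ℂ) := hfin
  exact Module.Finite.of_submodule_quotient (K.restrictScalars ℂ)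

/-- A left Noetherian algebraic complex algebra is finite-dimensional. -/
lemma finite_of_noetherian_algebraic {B : Type*} [Ring B] [Algebra ℂ B] [IsNoetherianRing B]
    (halg : ∀ x : B, IsAlgebraic ℂ x) : FiniteDimensional ℂ B := by
  have main : ∀ I : Ideal B, I.IsTwoSided → FiniteDimensional ℂ (B ⧸ I) := by
    intro I
    induction I using WellFoundedGT.induction with
    | ind I ih =>
    intro hI
    have hsurj : Function.Surjective (Ideal.Quotient.mkₐ ℂ I) := Ideal.Quotient.mkₐ_surjective ℂ I
    have : IsNoetherianRing (B ⧸ I) :=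
      isNoetherianRing_of_surjective B (B ⧸ I) (Ideal.Quotient.mk I) Ideal.Quotient.mk_surjective
    refine finite_of_proper_quot ?_ ?_
    · intro x
      obtain ⟨y, rfl⟩ := hsurj x
      exact (halg y).algHom _
    · intro K hK hK0
      let L : Ideal B := K.comap (Ideal.Quotient.mk I)
      have hIL : I < L := by
        refine lt_of_le_of_ne ?_ ?_
        · intro a ha
          rw [Ideal.mem_comap, Ideal.Quotient.eq_zero_iff_mem.2 ha]; exact zero_mem _
        · intro h
          apply hK0
          rw [eq_bot_iff]
          intro z hz
          obtain ⟨y, rfl⟩ := Ideal.Quotient.mk_surjective z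
          have : y ∈ L := hz
          rw [← h] at this
          simpa using Ideal.Quotient.eq_zero_iff_mem.2 this
      have hL2 : L.IsTwoSided := inferInstance
      have hfin : FiniteDimensional ℂ (B ⧸ L.restrictScalars ℂ) := ih L hIL hL2
      let g : B →ₗ[ℂ] ((B ⧸ I) ⧸ K) :=
        (Ideal.Quotient.mkₐ ℂ K).toLinearMap ∘ₗ (Ideal.Quotient.mkₐ ℂ I).toLinearMap
      have hg : L.restrictScalars ℂ ≤ LinearMap.ker g := by
        intro a ha
        exact Ideal.Quotient.eq_zero_iff_mem.2 ha
      refine Module.Finite.of_surjective (Submodule.liftQ _ g hg) ?_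
      intro z
      obtain ⟨y, rfl⟩ := Ideal.Quotient.mkₐ_surjective ℂ K z
      obtain ⟨w, rfl⟩ := hsurj y
      exact ⟨Submodule.Quotient.mk w, rfl⟩
  have h := main ⊥ inferInstance
  have hb : FiniteDimensional ℂ (B ⧸ (⊥ : Ideal B).restrictScalars ℂ) := h
  have : FiniteDimensional ℂ ((⊥ : Ideal B).restrictScalars ℂ) := by
    rw [Submodule.restrictScalars_bot]; infer_instance
  exact Module.Finite.of_submodule_quotient ((⊥ : Ideal B).restrictScalars ℂ)

open Polynomial in
/-- Operator with all `p(T)` of closed range and stabilising kernels is algebraic. -/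
lemma op_eq_zero {M : Type*} [NormedAddCommGroup M] [NormedSpace ℂ M] [CompleteSpace M]
    (T : M →L[ℂ] M) (hinj : ∀ l : ℂ, Function.Injective (T - algebraMap ℂ (M →L[ℂ] M) l))
    (hcl : ∀ l : ℂ, IsClosed (Set.range (T - algebraMap ℂ (M →L[ℂ] M) l))) :
    Subsingleton M := by
  by_contra hM
  rw [not_subsingleton_iff_nontrivial] at hM
  obtain ⟨l, hl, hlr⟩ := spectrum.exists_nnnorm_eq_spectralRadius T
  set S := T - algebraMap ℂ (M →L[ℂ] M) l with hS
  obtain ⟨K, hK⟩ := (ContinuousLinearMap.isClosed_range_iff_antilipschitz_of_injective S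
    (hinj l)).1 (hcl l)
  obtain ⟨r, hr0, hr⟩ : ∃ r : ℝ, 0 < r ∧ r * (2 * (K : ℝ)) < 1 := by
    refine ⟨1 / (2 * K + 1), by positivity, ?_⟩
    rw [div_mul_eq_mul_div, one_mul, div_lt_one (by positivity)]; linarith
  -- a nearby point outside of the spectrum
  obtain ⟨m, hm, hml⟩ : ∃ m : ℂ, m ∉ spectrum ℂ T ∧ ‖m - l‖ = r := by
    have key : ∀ m : ℂ, ‖l‖ < ‖m‖ → m ∉ spectrum ℂ T := by
      intro m hm hmem
      have : (‖m‖₊ : ENNReal) ≤ spectralRadius ℂ T := by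
        unfold spectralRadius
        exact le_iSup₂ (f := fun (k : ℂ) (_ : k ∈ spectrum ℂ T) => (‖k‖₊ : ENNReal)) m hmem
      rw [← hlr] at this
      have : ‖m‖₊ ≤ ‖l‖₊ := by exact_mod_cast this
      exact absurd hm (not_lt.2 this)
    by_cases h0 : l = 0
    · refine ⟨r, key _ ?_, ?_⟩
      · simp [h0, abs_of_pos hr0, hr0]
      · simp [h0, abs_of_pos hr0]
    · have hl0 : 0 < ‖l‖ := norm_pos_iff.2 h0
      refine ⟨l + (r / ‖l‖ : ℝ) * l, key _ ?_, ?_⟩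
      · have : l + (r / ‖l‖ : ℝ) * l = ((1 + r / ‖l‖ : ℝ) : ℂ) * l := by push_cast; ring
        rw [this, norm_mul, Complex.norm_real, Real.norm_of_nonneg (by positivity)]
        have : (1 + r / ‖l‖) * ‖l‖ = ‖l‖ + r := by field_simp
        linarith
      · rw [add_sub_cancel_left, norm_mul, Complex.norm_real, Real.norm_of_nonneg (by positivity)]
        field_simp
  rw [spectrum.notMem_iff] at hm
  obtain ⟨U, hU⟩ := hm
  apply hl
  -- `m - T` is invertible
  have hSU : algebraMap ℂ (M →L[ℂ] M) l - T = U + algebraMap ℂ _ (l - m) := by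
    rw [hU, map_sub]; abel
  have hinvb : ‖((U⁻¹ : (M →L[ℂ] M)ˣ) : M →L[ℂ] M)‖ ≤ 2 * K := by
    refine ContinuousLinearMap.opNorm_le_bound _ (by positivity) fun y => ?_
    set z := ((U⁻¹ : (M →L[ℂ] M)ˣ) : M →L[ℂ] M) y with hz
    have hUz : (U : M →L[ℂ] M) z = y := by
      rw [hz, ← mul_apply_eq_comp, Units.mul_inv]; rfl
    have h1 : ‖z‖ ≤ K * ‖S z‖ := by
      simpa using hK.le_mul_dist z 0
    have h2 : S z = (m - l) • z - y := by
      rw [← hUz, hU, hS]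
      simp [Algebra.algebraMap_eq_smul_one, sub_smul]
    have h3 : ‖S z‖ ≤ r * ‖z‖ + ‖y‖ := by
      rw [h2]
      refine (norm_sub_le _ _).trans ?_
      rw [norm_smul, hml]
    have h4 : (K : ℝ) * ‖S z‖ ≤ K * (r * ‖z‖ + ‖y‖) := by gcongr
    nlinarith [norm_nonneg z, norm_nonneg y]
  have hlt : ‖algebraMap ℂ (M →L[ℂ] M) (l - m)‖ < ‖((U⁻¹ : (M →L[ℂ] M)ˣ) : M →L[ℂ] M)‖⁻¹ := by
    rw [norm_algebraMap', norm_sub_rev, hml]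
    have hp : 0 < ‖((U⁻¹ : (M →L[ℂ] M)ˣ) : M →L[ℂ] M)‖ := Units.norm_pos _
    rw [lt_inv_comm₀ hr0 hp]
    refine hinvb.trans_lt ?_
    rw [lt_inv_comm₀ (by linarith) hr0, inv_eq_one_div, lt_div_iff₀ (by linarith)]
    exact hr
  rw [spectrum.mem_resolventSet_iff]
  rw [hSU]
  exact ⟨Units.add U _ hlt, rfl⟩

open Polynomial in
/-- Operator with all `p(T)` of closed range and stabilising kernels is algebraic. -/
lemma op_algebraic {E : Type*} [NormedAddCommGroup E] [NormedSpace ℂ E] [CompleteSpace E]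
    (T : E →L[ℂ] E) (hcl : ∀ q : ℂ[X], IsClosed (Set.range (aeval T q)))
    (p : ℂ[X]) (hst : ∀ l : ℂ, ∀ x, aeval T (p * (X - C l)) x = 0 → aeval T p x = 0) :
    aeval T p = 0 := by
  let M : Submodule ℂ E := LinearMap.range (aeval T p).toLinearMap
  have hM : IsClosed (M : Set E) := by
    convert hcl p
    ext; simp [M]
  have : CompleteSpace M := hM.completeSpace_coe
  have hcomm : ∀ x, aeval T p (T x) = T (aeval T p x) := by
    intro x
    have : aeval T (p * X) = aeval T (X * p) := by rw [mul_comm]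
    simpa using congrArg (fun f => f x) this
  let TM : M →L[ℂ] M := (T.comp M.subtypeL).codRestrict M (by
    rintro ⟨_, ⟨x, rfl⟩⟩
    exact ⟨T x, hcomm x⟩)
  have hTM : ∀ (l : ℂ) (y : M), (((TM - algebraMap ℂ _ l) y : M) : E) = T y - l • (y : E) := by
    intro l y
    simp [TM, Algebra.algebraMap_eq_smul_one]
  have hpl : ∀ l x, aeval T (p * (X - C l)) x = T (aeval T p x) - l • aeval T p x := by
    intro l x
    rw [mul_comm]
    simp [Algebra.algebraMap_eq_smul_one]
  have hsub : Subsingleton M := by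
    refine op_eq_zero TM ?_ ?_
    · intro l
      rw [injective_iff_map_eq_zero]
      rintro ⟨_, ⟨x, rfl⟩⟩ hy
      have := congrArg (Subtype.val) hy
      rw [hTM] at this
      ext
      apply hst l
      rw [hpl]; exact this
    · intro l
      have : Set.range (TM - algebraMap ℂ (M →L[ℂ] M) l) =
          Subtype.val ⁻¹' (Set.range (aeval T (p * (X - C l)))) := by
        ext y
        constructor
        · rintro ⟨⟨_, ⟨x, rfl⟩⟩, rfl⟩
          exact ⟨x, by rw [hTM, hpl]; rfl⟩
        · rintro ⟨x, hx⟩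
          refine ⟨⟨aeval T p x, ⟨x, rfl⟩⟩, ?_⟩
          ext
          rw [hTM, ← hx, hpl]
      rw [this]
      exact (hcl _).preimage continuous_subtype_val
  ext x
  have := Subsingleton.elim (⟨aeval T p x, ⟨x, rfl⟩⟩ : M) 0
  exact congrArg Subtype.val this

section Gen
variable {A : Type*} [NonUnitalNonAssocSemiring A] [Module ℂ A]

lemma leftIdealGen_isLeftIdeal (S : Set A) : IsLeftIdeal (leftIdealGen S) := by
  intro a x hx
  unfold leftIdealGen at *
  rw [Submodule.mem_sInf] at *
  intro I hI
  exact hI.1 a x (hx I hI)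

lemma subset_leftIdealGen (S : Set A) : S ⊆ (leftIdealGen S : Set A) := by
  intro x hx
  unfold leftIdealGen
  rw [SetLike.mem_coe, Submodule.mem_sInf]
  intro I hI
  exact hI.2 hx

lemma leftIdealGen_le {S : Set A} {I : Submodule ℂ A} (hI : IsLeftIdeal I) (hS : S ⊆ (I : Set A)) :
    leftIdealGen S ≤ I := sInf_le ⟨hI, hS⟩

lemma IsFGLeftIdeal.isCG {I : Submodule ℂ A} (h : IsFGLeftIdeal I) : IsCGLeftIdeal I := by
  obtain ⟨S, h1, h2⟩ := h
  exact ⟨S, S.countable_toSet, h1, h2⟩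

end Gen

/-- Surjections onto a closed subspace are stable under small perturbations. -/
lemma surj_perturb {X A : Type*} [NormedAddCommGroup X] [NormedSpace ℂ X] [CompleteSpace X]
    [NormedAddCommGroup A] [NormedSpace ℂ A] [CompleteSpace A]
    (E : Submodule ℂ A) (hE : IsClosed (E : Set A)) (f : X →L[ℂ] A) (hf : ∀ a, f a ∈ E)
    (hsurj : ∀ y ∈ E, ∃ a, f a = y) :
    ∃ ε : ℝ, 0 < ε ∧ ∀ g : X →L[ℂ] A, (∀ a, g a ∈ E) → ‖g - f‖ ≤ ε → ∀ y ∈ E, ∃ a, g a = y := by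
  have : CompleteSpace E := hE.completeSpace_coe
  let f' : X →L[ℂ] E := f.codRestrict E hf
  have hf' : f'.range = ⊤ := by
    rw [LinearMap.range_eq_top]
    rintro ⟨y, hy⟩
    obtain ⟨a, ha⟩ := hsurj y hy
    exact ⟨a, Subtype.ext ha⟩
  let N := f'.nonlinearRightInverseOfSurjective hf'
  have hN : 0 < N.nnnorm := f'.nonlinearRightInverseOfSurjective_nnnorm_pos hf'
  have hN' : (0 : ℝ) < (N.nnnorm : ℝ)⁻¹ := inv_pos.2 hN
  refine ⟨(N.nnnorm : ℝ)⁻¹ / 2, by positivity, ?_⟩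
  intro g hg hgf y hy
  let g' : X →L[ℂ] E := g.codRestrict E hg
  have happ : ApproximatesLinearOn g' f' Set.univ (N.nnnorm⁻¹ / 2) := by
    intro x _ y _
    have h1 : ((g' x - g' y - f' (x - y) : E) : A) = (g - f) (x - y) := by
      simp [g', f']
    have h2 : ‖g' x - g' y - f' (x - y)‖ = ‖(g - f) (x - y)‖ := by rw [← h1]; rfl
    rw [h2]
    refine ((g - f).le_opNorm _).trans ?_
    have : ((N.nnnorm⁻¹ / 2 : NNReal) : ℝ) = (N.nnnorm : ℝ)⁻¹ / 2 := by push_cast; rfl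
    rw [this]
    gcongr
  set d := (N.nnnorm : ℝ)⁻¹ - ((N.nnnorm⁻¹ / 2 : NNReal) : ℝ) with hd
  have hdpos : 0 < d := by
    rw [hd]; push_cast; linarith
  have := happ.surjOn_closedBall_of_nonlinearRightInverse N (b := 0) (ε := ‖y‖ / d)
    (by positivity) (Set.subset_univ _)
  have hmem : (⟨y, hy⟩ : E) ∈ Metric.closedBall (g' 0) (d * (‖y‖ / d)) := by
    rw [map_zero, mem_closedBall_zero_iff, mul_div_cancel₀ _ hdpos.ne']
    exact le_rfl
  obtain ⟨a, _, ha⟩ := this hmem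
  exact ⟨a, congrArg Subtype.val ha⟩

/-- Sum of a sequence of operators. -/
def opSum {V W : Type*} [NormedAddCommGroup V] [NormedSpace ℂ V] [NormedAddCommGroup W]
    [NormedSpace ℂ W] (T : ℕ → V →L[ℂ] W) : V →L[ℂ] W := ∑' i, T i

lemma hasSum_opSum {V W : Type*} [NormedAddCommGroup V] [NormedSpace ℂ V] [NormedAddCommGroup W]
    [NormedSpace ℂ W] [CompleteSpace W] (T : ℕ → V →L[ℂ] W) (c : ℕ → ℝ) (hc : Summable c)
    (hT : ∀ i, ‖T i‖ ≤ c i) (v : V) : HasSum (fun i => T i v) (opSum T v) := by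
  have hs : Summable T := Summable.of_norm_bounded hc hT
  exact hs.hasSum.mapL (ContinuousLinearMap.apply ℂ W v)

lemma norm_opSum_sub {V W : Type*} [NormedAddCommGroup V] [NormedSpace ℂ V]
    [NormedAddCommGroup W] [NormedSpace ℂ W] [CompleteSpace W] (T S : ℕ → V →L[ℂ] W)
    (c d k : ℕ → ℝ) (hc : Summable c) (hT : ∀ i, ‖T i‖ ≤ c i)
    (hd : Summable d) (hS : ∀ i, ‖S i‖ ≤ d i) (hk : Summable k) (hTS : ∀ i, ‖T i - S i‖ ≤ k i) :
    ‖opSum T - opSum S‖ ≤ ∑' i, k i := by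
  have h1 : Summable T := Summable.of_norm_bounded hc hT
  have h2 : Summable S := Summable.of_norm_bounded hd hS
  unfold opSum
  rw [← h1.tsum_sub h2]
  exact tsum_of_norm_bounded hk.hasSum hTS

section Banach
variable {A : Type*} [NonUnitalNormedRing A] [NormedSpace ℂ A]
    [IsScalarTower ℂ A A] [SMulCommClass ℂ A A]

/-- The action `(l, a) ↦ l x + a x`. -/
def actL (x : A) : (ℂ × A) →L[ℂ] A :=
  (ContinuousLinearMap.fst ℂ ℂ A).smulRight x +
    ((ContinuousLinearMap.mul ℂ A).flip x).comp (ContinuousLinearMap.snd ℂ ℂ A)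

lemma actL_apply (x : A) (c : ℂ × A) : actL x c = c.1 • x + c.2 * x := rfl

lemma norm_actL (x : A) : ‖actL x‖ ≤ 2 * ‖x‖ := by
  refine ContinuousLinearMap.opNorm_le_bound _ (by positivity) fun c => ?_
  rw [actL_apply]
  have h1 : ‖c.1 • x‖ ≤ ‖c‖ * ‖x‖ := by
    rw [norm_smul]; gcongr; exact norm_fst_le c
  have h2 : ‖c.2 * x‖ ≤ ‖c‖ * ‖x‖ := by
    refine (norm_mul_le _ _).trans ?_
    gcongr; exact norm_snd_le c
  linarith [norm_add_le (c.1 • x) (c.2 * x)]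

open BoundedContinuousFunction in
/-- One term of the generating map. -/
def phiTerm (x : ℕ → A) (i : ℕ) : (ℕ →ᵇ (ℂ × A)) →L[ℂ] A :=
  (actL (x i)).comp (evalCLM ℂ i)

open BoundedContinuousFunction in
lemma phiTerm_apply (x : ℕ → A) (i : ℕ) (a : ℕ →ᵇ (ℂ × A)) :
    phiTerm x i a = (a i).1 • x i + (a i).2 * x i := rfl

open BoundedContinuousFunction in
lemma norm_phiTerm (x : ℕ → A) (i : ℕ) : ‖phiTerm x i‖ ≤ 2 * ‖x i‖ := by
  refine ContinuousLinearMap.opNorm_le_bound _ (by positivity) fun a => ?_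
  have : phiTerm x i a = actL (x i) (a i) := rfl
  rw [this]
  refine ((actL (x i)).le_opNorm _).trans ?_
  gcongr
  · exact norm_actL _
  · exact a.norm_coe_le_norm i

open BoundedContinuousFunction in
/-- The generating map `a ↦ ∑ aᵢ xᵢ`. -/
def phi (x : ℕ → A) : (ℕ →ᵇ (ℂ × A)) →L[ℂ] A := opSum (phiTerm x)

variable [CompleteSpace A]

open BoundedContinuousFunction in
lemma hasSum_phi {x : ℕ → A} (hx : Summable fun i => ‖x i‖) (a : ℕ →ᵇ (ℂ × A)) :
    HasSum (fun i => (a i).1 • x i + (a i).2 * x i) (phi x a) :=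
  hasSum_opSum (phiTerm x) _ (hx.mul_left 2) (norm_phiTerm x) a

lemma norm_phi_sub {x y : ℕ → A} (hx : Summable fun i => ‖x i‖) (hy : Summable fun i => ‖y i‖)
    (hxy : Summable fun i => ‖y i - x i‖) :
    ‖phi y - phi x‖ ≤ 2 * ∑' i, ‖y i - x i‖ := by
  rw [← tsum_mul_left]
  refine norm_opSum_sub (phiTerm y) (phiTerm x) _ _ _ (hy.mul_left 2) (norm_phiTerm y)
    (hx.mul_left 2) (norm_phiTerm x) (hxy.mul_left 2) ?_
  intro i
  have : phiTerm y i - phiTerm x i = phiTerm (fun i => y i - x i) i := by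
    refine ContinuousLinearMap.ext fun a => ?_
    rw [sub_apply, phiTerm_apply, phiTerm_apply, phiTerm_apply, smul_sub,
      mul_sub]
    abel
  rw [this]
  exact norm_phiTerm _ i

lemma closure_isLeftIdeal {I : Submodule ℂ A} (hI : IsLeftIdeal I) :
    IsLeftIdeal I.topologicalClosure := by
  intro a x hx
  have : Set.MapsTo (fun x => a * x) (closure (I : Set A)) (closure (I : Set A)) :=
    Set.MapsTo.closure (fun x hx => hI a x hx) (continuous_const.mul continuous_id)
  exact this hx

open BoundedContinuousFunction in
/-- A left ideal with countably generated closure is closed and finitely generated. -/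
lemma closed_fg_of_closure_cg {I : Submodule ℂ A} (hI : IsLeftIdeal I)
    (hcg : IsCGLeftIdeal I.topologicalClosure) : IsClosed (I : Set A) ∧ IsFGLeftIdeal I := by
  obtain ⟨S, hSc, hSE, hgen⟩ := hcg
  set E := I.topologicalClosure with hEdef
  have hEcl : IsClosed (E : Set A) := I.isClosed_topologicalClosure
  have hEl : IsLeftIdeal E := closure_isLeftIdeal hI
  have hIE : I ≤ E := I.le_topologicalClosure
  obtain ⟨s, hs⟩ := (hSc.insert 0).exists_eq_range (Set.insert_nonempty 0 S)
  have hsE : ∀ i, s i ∈ E := by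
    intro i
    have : s i ∈ insert 0 S := by rw [hs]; exact ⟨i, rfl⟩
    rcases this with h | h
    · rw [h]; exact zero_mem _
    · exact hSE h
  -- scaling
  let t : ℕ → ℝ := fun i => (1 / 2) ^ i / (1 + ‖s i‖)
  have ht : ∀ i, 0 < t i := fun i => by positivity
  let x : ℕ → A := fun i => (t i : ℂ) • s i
  have hxE : ∀ i, x i ∈ E := fun i => E.smul_mem _ (hsE i)
  have hx : Summable fun i => ‖x i‖ := by
    refine Summable.of_nonneg_of_le (fun i => norm_nonneg _) (fun i => ?_)
      summable_geometric_two
    rw [norm_smul, Complex.norm_real, Real.norm_of_nonneg (ht i).le, div_mul_eq_mul_div,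
      div_le_iff₀ (by positivity)]
    have : (0 : ℝ) < (1 / 2) ^ i := by positivity
    nlinarith [norm_nonneg (s i)]
  have hmem : ∀ y : ℕ → A, (∀ i, y i ∈ E) → (Summable fun i => ‖y i‖) → ∀ a, phi y a ∈ E := by
    intro y hy hys a
    refine hEcl.mem_of_tendsto (hasSum_phi hys a) (Filter.Eventually.of_forall fun F => ?_)
    exact E.sum_mem fun i _ => E.add_mem (E.smul_mem _ (hy i)) (hEl _ _ (hy i))
  have hsurj : ∀ y ∈ E, ∃ a, phi x a = y := by
    have hle : leftIdealGen S ≤ LinearMap.range (phi x).toLinearMap := by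
      refine leftIdealGen_le ?_ ?_
      · rintro b _ ⟨a, rfl⟩
        let L : (ℂ × A) →L[ℂ] (ℂ × A) := (ContinuousLinearMap.inr ℂ ℂ A).comp
          ((ContinuousLinearMap.fst ℂ ℂ A).smulRight b +
            (ContinuousLinearMap.mul ℂ A b).comp (ContinuousLinearMap.snd ℂ ℂ A))
        refine ⟨L.compLeftContinuousBounded ℕ a, ?_⟩
        have h1 := (hasSum_phi hx a).mapL (ContinuousLinearMap.mul ℂ A b)
        have h2 := hasSum_phi hx (L.compLeftContinuousBounded ℕ a)
        refine h2.unique ?_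
        have h3 : (fun i => ((L.compLeftContinuousBounded ℕ a) i).1 • x i +
            ((L.compLeftContinuousBounded ℕ a) i).2 * x i) =
            fun i => b * ((a i).1 • x i + (a i).2 * x i) := by
          ext i
          have h4 : (L.compLeftContinuousBounded ℕ a) i = (0, (a i).1 • b + b * (a i).2) := rfl
          rw [h4, zero_smul, zero_add, add_mul, mul_add, smul_mul_assoc,
            mul_smul_comm (a i).1 b (x i), mul_assoc]
        rw [h3]
        exact h1
      · intro z hz
        have : z ∈ insert 0 S := Or.inr hz
        rw [hs] at this
        obtain ⟨i, rfl⟩ := this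
        classical
        let a : ℕ →ᵇ (ℂ × A) := ofNormedAddCommGroupDiscrete
          (fun j => if j = i then (((t i : ℂ)⁻¹, 0) : ℂ × A) else 0)
          ‖(((t i : ℂ)⁻¹, 0) : ℂ × A)‖ (by
            intro j; split_ifs
            · exact le_rfl
            · rw [norm_zero]; exact norm_nonneg _)
        refine ⟨a, ?_⟩
        have h2 := hasSum_phi hx a
        refine h2.unique ?_
        have h3 := hasSum_ite_eq i (s i)
        convert h3 using 2 with j
        have haj : a j = if j = i then (((t i : ℂ)⁻¹, 0) : ℂ × A) else 0 := rfl
        rw [haj]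
        split_ifs with hji
        · subst hji
          have : (t j : ℂ) ≠ 0 := by exact_mod_cast (ht j).ne'
          have h5 : x j = (t j : ℂ) • s j := rfl
          rw [h5, zero_mul, add_zero, smul_smul, inv_mul_cancel₀ this, one_smul]
        · simp
    intro y hy
    rw [← hgen] at hy
    exact hle hy
  obtain ⟨ε, hε, hpert⟩ := surj_perturb E hEcl (phi x) (hmem x hxE hx) hsurj
  -- choose the truncation
  obtain ⟨n, hn⟩ : ∃ n, ∑' i, ‖x (i + n)‖ < ε / 4 :=
    ((tendsto_sum_nat_add fun i => ‖x i‖).eventually (gt_mem_nhds (by positivity))).exists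
  have happ : ∀ i, ∃ z ∈ I, ‖z - x i‖ < ε / 4 / (n + 1) := by
    intro i
    have : x i ∈ closure (I : Set A) := hxE i
    rw [Metric.mem_closure_iff] at this
    obtain ⟨z, hz, hd⟩ := this (ε / 4 / (n + 1)) (by positivity)
    exact ⟨z, hz, by rwa [← dist_eq_norm, dist_comm]⟩
  choose z hzI hz using happ
  let y : ℕ → A := fun i => if i < n then z i else 0
  have hyI : ∀ i, y i ∈ I := by
    intro i; simp only [y]; split_ifs
    · exact hzI i
    · exact zero_mem _
  have hy0 : ∀ i ∉ Finset.range n, y i = 0 := by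
    intro i hi; simp only [Finset.mem_range] at hi; simp [y, hi]
  have hy : Summable fun i => ‖y i‖ :=
    summable_of_ne_finset_zero (s := Finset.range n) fun i hi => by rw [hy0 i hi, norm_zero]
  have hxy : Summable fun i => ‖y i - x i‖ :=
    Summable.of_nonneg_of_le (fun i => norm_nonneg _) (fun i => norm_sub_le _ _) (hy.add hx)
  have hbd : ∑' i, ‖y i - x i‖ ≤ ε / 2 := by
    rw [← hxy.sum_add_tsum_nat_add n]
    have h1 : ∑ i ∈ Finset.range n, ‖y i - x i‖ ≤ ε / 4 := by
      calc ∑ i ∈ Finset.range n, ‖y i - x i‖ ≤ ∑ i ∈ Finset.range n, ε / 4 / (n + 1) := by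
            refine Finset.sum_le_sum fun i hi => ?_
            have : y i = z i := by simp [y, Finset.mem_range.1 hi]
            rw [this]; exact (hz i).le
        _ = n * (ε / 4 / (n + 1)) := by simp
        _ ≤ ε / 4 := by
            rw [mul_div_assoc', div_le_iff₀ (by positivity)]; nlinarith
    have h2 : ∑' i, ‖y (i + n) - x (i + n)‖ = ∑' i, ‖x (i + n)‖ := by
      congr 1; ext i; rw [hy0 (i + n) (by simp), zero_sub, norm_neg]
    rw [h2]; linarith
  have hfin := hpert (phi y) (hmem y (fun i => hIE (hyI i)) hy)
    ((norm_phi_sub hx hy hxy).trans (by linarith))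
  classical
  let G := leftIdealGen (((Finset.range n).image y : Finset A) : Set A)
  have hGsub : (((Finset.range n).image y : Finset A) : Set A) ⊆ (I : Set A) := by
    intro w hw
    simp only [Finset.coe_image, Set.mem_image] at hw
    obtain ⟨i, _, rfl⟩ := hw
    exact hyI i
  have hGI : G ≤ I := leftIdealGen_le hI hGsub
  have hEG : E ≤ G := by
    intro w hw
    obtain ⟨a, rfl⟩ := hfin w hw
    have h1 : phi y a = ∑ i ∈ Finset.range n, ((a i).1 • y i + (a i).2 * y i) := by
      rw [← (hasSum_phi hy a).tsum_eq]
      exact tsum_eq_sum fun i hi => by simp [hy0 i hi]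
    rw [h1]
    refine G.sum_mem fun i hi => ?_
    have : y i ∈ G := subset_leftIdealGen _ (by
      simp only [Finset.coe_image]; exact ⟨i, by simpa using hi, rfl⟩)
    exact G.add_mem (G.smul_mem _ this) (leftIdealGen_isLeftIdeal _ _ _ this)
  have hEI : E = I := le_antisymm (hEG.trans hGI) hIE
  refine ⟨hEI ▸ hEcl, _, hGsub, le_antisymm hGI (hIE.trans hEG)⟩

end Banach

section Final

/-- Chains of non-finitely-generated left ideals: Zorn. -/
lemma exists_maxNonFG {A : Type*} [NonUnitalNonAssocSemiring A] [Module ℂ A]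
    (J : Submodule ℂ A) (hJ : IsLeftIdeal J) (hJfg : ¬ IsFGLeftIdeal J) :
    ∃ M : Submodule ℂ A, IsMaxNonFG M := by
  obtain ⟨M, _, hM⟩ := zorn_le_nonempty₀
    {J : Submodule ℂ A | IsLeftIdeal J ∧ ¬ IsFGLeftIdeal J} (by
      intro c hc hchain y hy
      have hdir : DirectedOn (· ≤ ·) c := hchain.directedOn
      have hne : c.Nonempty := ⟨y, hy⟩
      refine ⟨sSup c, ⟨?_, ?_⟩, fun z hz => le_sSup hz⟩
      · intro a x hx
        rw [Submodule.mem_sSup_of_directed hne hdir] at hx ⊢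
        obtain ⟨K, hK, hxK⟩ := hx
        exact ⟨K, hK, (hc hK).1 a x hxK⟩
      · rintro ⟨S, hS, hgen⟩
        have hex : ∀ F : Finset A, (F : Set A) ⊆ ((sSup c : Submodule ℂ A) : Set A) →
            ∃ K ∈ c, (F : Set A) ⊆ (K : Set A) := by
          classical
          intro F
          induction F using Finset.induction_on with
          | empty => intro _; exact ⟨y, hy, by simp⟩
          | insert a F _ ih =>
            intro h
            rw [Finset.coe_insert, Set.insert_subset_iff] at h
            obtain ⟨K, hK, hFK⟩ := ih h.2
            obtain ⟨K', hK', haK'⟩ := (Submodule.mem_sSup_of_directed hne hdir).1 h.1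
            obtain ⟨K'', hK'', h1, h2⟩ := hdir K hK K' hK'
            refine ⟨K'', hK'', ?_⟩
            rw [Finset.coe_insert, Set.insert_subset_iff]
            exact ⟨h2 haK', fun z hz => h1 (hFK hz)⟩
        obtain ⟨K, hK, hSK⟩ := hex S hS
        have h1 : sSup c ≤ K := hgen ▸ leftIdealGen_le (hc hK).1 hSK
        have h2 : K = sSup c := le_antisymm (le_sSup hK) h1
        exact (hc hK).2 ⟨S, hSK, by rw [hgen, h2]⟩) J ⟨hJ, hJfg⟩
  refine ⟨M, hM.prop.1, hM.prop.2, fun K hK hKfg hMK => ?_⟩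
  exact le_antisymm (hM.le_of_ge ⟨hK, hKfg⟩ hMK) hMK

variable {A : Type*} [NonUnitalNormedRing A] [NormedSpace ℂ A]
    [IsScalarTower ℂ A A] [SMulCommClass ℂ A A]

/-- The unitization is left Noetherian when all left ideals are finitely generated. -/
lemma unitization_noetherian (hfg : ∀ I : Submodule ℂ A, IsLeftIdeal I → IsFGLeftIdeal I) :
    IsNoetherianRing (Unitization ℂ A) := by
  classical
  refine ⟨fun L => ?_⟩
  let res : Ideal (Unitization ℂ A) → Submodule ℂ A := fun L =>
    { carrier := {a | (a : Unitization ℂ A) ∈ L}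
      zero_mem' := by simp
      add_mem' := by
        intro a b ha hb
        change ((a + b : A) : Unitization ℂ A) ∈ L
        rw [Unitization.inr_add]; exact L.add_mem ha hb
      smul_mem' := by
        intro c a ha
        change ((c • a : A) : Unitization ℂ A) ∈ L
        have : ((c • a : A) : Unitization ℂ A) =
            (Unitization.inl c : Unitization ℂ A) * (a : Unitization ℂ A) := by
          rw [Unitization.inl_mul_inr]
        rw [this]; exact L.mul_mem_left _ ha }
  have hleft : ∀ L : Ideal (Unitization ℂ A), IsLeftIdeal (res L) := by
    intro L a x hx
    have hx' : (x : Unitization ℂ A) ∈ L := hx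
    have : ((a * x : A) : Unitization ℂ A) ∈ L := by
      rw [Unitization.inr_mul]; exact L.mul_mem_left _ hx'
    exact this
  obtain ⟨S, hS, hgen⟩ := hfg _ (hleft L)
  let T : Finset (Unitization ℂ A) := S.image (fun a : A => (a : Unitization ℂ A))
  have hTL : ∀ a ∈ T, a ∈ L := by
    intro a ha
    obtain ⟨b, hb, rfl⟩ := Finset.mem_image.1 ha
    exact hS hb
  have hcov : ∀ L' : Ideal (Unitization ℂ A), (∀ a ∈ T, a ∈ L') →
      ∀ a : A, (a : Unitization ℂ A) ∈ L → (a : Unitization ℂ A) ∈ L' := by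
    intro L' hL' a ha
    have h1 : leftIdealGen (S : Set A) ≤ _ := leftIdealGen_le (hleft L') (by
      intro b hb
      exact hL' _ (Finset.mem_image_of_mem _ hb))
    rw [hgen] at h1
    exact h1 ha
  by_cases hl : ∃ l ∈ L, l.fst ≠ 0
  · obtain ⟨l, hlL, hl0⟩ := hl
    refine ⟨insert l T, le_antisymm (Submodule.span_le.2 ?_) ?_⟩
    · intro a ha
      rcases Finset.mem_insert.1 (Finset.mem_coe.1 ha) with rfl | h
      · exact hlL
      · exact hTL a h
    · intro u hu
      set L' : Ideal (Unitization ℂ A) := Submodule.span _ (↑(insert l T)) with hL'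
      have hlL' : l ∈ L' := Submodule.subset_span (by simp)
      have hTL' : ∀ a ∈ T, a ∈ L' := fun a ha => Submodule.subset_span (by simp [ha])
      set k : Unitization ℂ A := algebraMap ℂ _ (u.fst / l.fst) with hk
      have h1 : u - k * l ∈ L := L.sub_mem hu (Ideal.mul_mem_left L _ hlL)
      have hfst : (u - k * l).fst = 0 := by
        rw [sub_eq_add_neg, Unitization.fst_add, Unitization.fst_neg, ← sub_eq_add_neg,
          Unitization.fst_mul, hk, Unitization.algebraMap_eq_inl,
          Unitization.fst_inl, div_mul_cancel₀ _ hl0, sub_self]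
      have h2 : u - k * l = ((u - k * l).snd : Unitization ℂ A) := by
        ext
        · rw [hfst, Unitization.fst_inr]
        · rw [Unitization.snd_inr]
      have h3 : u - k * l ∈ L' := by
        rw [h2]; apply hcov L' hTL'; rw [← h2]; exact h1
      have : u = (u - k * l) + k * l := by abel
      rw [this]
      exact L'.add_mem h3 (L'.mul_mem_left _ hlL')
  · push Not at hl
    refine ⟨T, le_antisymm (Submodule.span_le.2 hTL) ?_⟩
    intro u hu
    have h2 : u = (u.snd : Unitization ℂ A) := by
      ext
      · rw [hl u hu, Unitization.fst_inr]
      · rw [Unitization.snd_inr]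
    rw [h2]
    apply hcov _ (fun a ha => Submodule.subset_span ha)
    rw [← h2]; exact hu

/-- Right multiplication by `b`. -/
def rmul (b : A) : A →L[ℂ] A := (ContinuousLinearMap.mul ℂ A).flip b

lemma rmul_apply (b x : A) : rmul b x = x * b := rfl

open Polynomial in
lemma aeval_rmul_mul (b : A) (q : ℂ[X]) : ∀ (c x : A),
    aeval (rmul b) q (c * x) = c * aeval (rmul b) q x := by
  have hpow : ∀ (n : ℕ) (c x : A), (rmul b ^ n) (c * x) = c * (rmul b ^ n) x := by
    intro n
    induction n with
    | zero => intro c x; simp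
    | succ n ih =>
      intro c x
      rw [pow_succ, mul_apply_eq_comp, mul_apply_eq_comp, rmul_apply, rmul_apply,
        mul_assoc, ih]
  induction q using Polynomial.induction_on' with
  | add p q hp hq =>
    intro c x
    rw [map_add, add_apply, add_apply, hp, hq, mul_add]
  | monomial n a =>
    intro c x
    rw [aeval_monomial, Algebra.algebraMap_eq_smul_one, smul_mul_assoc, one_mul,
      smul_apply, smul_apply, hpow, mul_smul_comm]

open Polynomial in
lemma inr_aeval_rmul (b : A) (q : ℂ[X]) : ∀ (x : A),
    ((aeval (rmul b) q x : A) : Unitization ℂ A) =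
      (x : Unitization ℂ A) * aeval (b : Unitization ℂ A) q := by
  have hpow : ∀ (n : ℕ) (x : A), (((rmul b ^ n) x : A) : Unitization ℂ A) =
      (x : Unitization ℂ A) * (b : Unitization ℂ A) ^ n := by
    intro n
    induction n with
    | zero => intro x; simp
    | succ n ih =>
      intro x
      rw [pow_succ, mul_apply_eq_comp, rmul_apply, ih, Unitization.inr_mul, pow_succ',
        mul_assoc]
  induction q using Polynomial.induction_on' with
  | add p q hp hq =>
    intro x
    rw [map_add, add_apply, Unitization.inr_add, hp, hq, map_add, mul_add]
  | monomial n a =>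
    intro x
    rw [aeval_monomial, aeval_monomial, Algebra.algebraMap_eq_smul_one,
      Algebra.algebraMap_eq_smul_one, smul_mul_assoc, one_mul, smul_mul_assoc, one_mul,
      smul_apply, Unitization.inr_smul, hpow, mul_smul_comm]

variable [CompleteSpace A]

open Polynomial in
lemma algebraic_of_allFG (hfg : ∀ I : Submodule ℂ A, IsLeftIdeal I → IsFGLeftIdeal I)
    (b : A) : ∃ p : ℂ[X], p ≠ 0 ∧ aeval (b : Unitization ℂ A) p = 0 := by
  have hcl : ∀ I : Submodule ℂ A, IsLeftIdeal I → IsClosed (I : Set A) := fun I hI =>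
    (closed_fg_of_closure_cg hI (hfg _ (closure_isLeftIdeal hI)).isCG).1
  have hN := unitization_noetherian hfg
  -- kernels, as left ideals of the unitization
  let ann : ℂ[X] → Ideal (Unitization ℂ A) := fun q =>
    { carrier := {u | u.fst = 0 ∧ aeval (rmul b) q u.snd = 0}
      zero_mem' := by simp
      add_mem' := by
        rintro u v ⟨h1, h2⟩ ⟨h3, h4⟩
        exact ⟨by rw [Unitization.fst_add, h1, h3, add_zero],
          by rw [Unitization.snd_add, map_add, h2, h4, add_zero]⟩
      smul_mem' := by
        rintro c u ⟨h1, h2⟩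
        refine ⟨by rw [smul_eq_mul, Unitization.fst_mul, h1, mul_zero], ?_⟩
        rw [smul_eq_mul, Unitization.snd_mul, h1, zero_smul, add_zero, map_add,
          map_smul, h2, smul_zero, zero_add, aeval_rmul_mul, h2, mul_zero] }
  obtain ⟨_, ⟨p, hp0, rfl⟩, hmax⟩ := set_has_maximal_iff_noetherian.2
      (inferInstanceAs (IsNoetherian (Unitization ℂ A) (Unitization ℂ A)))
      (ann '' {q | q ≠ 0}) ⟨_, 1, one_ne_zero, rfl⟩
  have hzero : aeval (rmul b) p = 0 := by
    refine op_algebraic (rmul b) ?_ p ?_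
    · intro q
      have hli : IsLeftIdeal (LinearMap.range (aeval (rmul b) q).toLinearMap) := by
        rintro c _ ⟨x, rfl⟩
        exact ⟨c * x, aeval_rmul_mul b q c x⟩
      exact hcl _ hli
    · intro l x hx
      have hne : p * (X - C l) ≠ 0 := mul_ne_zero hp0 (X_sub_C_ne_zero l)
      have hle : ann p ≤ ann (p * (X - C l)) := by
        rintro u ⟨h1, h2⟩
        refine ⟨h1, ?_⟩
        rw [mul_comm, map_mul, mul_apply_eq_comp, h2, map_zero]
      have heq : ann p = ann (p * (X - C l)) := by
        by_contra h
        exact hmax _ ⟨_, hne, rfl⟩ (lt_of_le_of_ne hle h)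
      have hmem : (x : Unitization ℂ A) ∈ ann (p * (X - C l)) :=
        ⟨Unitization.fst_inr _ _, by rw [Unitization.snd_inr]; exact hx⟩
      rw [← heq] at hmem
      have := hmem.2
      rwa [Unitization.snd_inr] at this
  refine ⟨X * p, mul_ne_zero X_ne_zero hp0, ?_⟩
  rw [map_mul, aeval_X, ← inr_aeval_rmul, hzero]
  simp

open Polynomial in
/-- Sinclair–Tullo. -/
lemma finite_of_allFG (hfg : ∀ I : Submodule ℂ A, IsLeftIdeal I → IsFGLeftIdeal I) :
    FiniteDimensional ℂ A := by
  have hN := unitization_noetherian hfg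
  have hfin : FiniteDimensional ℂ (Unitization ℂ A) := by
    refine finite_of_noetherian_algebraic fun u => ?_
    obtain ⟨p, hp0, hp⟩ := algebraic_of_allFG hfg u.snd
    refine ⟨p.comp (X + C (-u.fst)), ?_, ?_⟩
    · rw [Ne, comp_X_add_C_eq_zero_iff]; exact hp0
    · rw [aeval_comp]
      have : aeval u (X + C (-u.fst)) = (u.snd : Unitization ℂ A) := by
        rw [map_add, aeval_X, aeval_C, Unitization.algebraMap_eq_inl]
        ext <;> simp
      rw [this, hp]
  exact Module.Finite.of_injective (Unitization.inrHom ℂ ℂ A) Unitization.inr_injective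

end Final

/-- For an infinite-dimensional Banach algebra `A`, the families
`𝔐∞(A)` and `𝔑∞(A)` coincide, are non-empty, and all their members are closed. -/
theorem maxNonFG_eq_maxNonCG {A : Type*} [NonUnitalNormedRing A] [NormedSpace ℂ A]
    [IsScalarTower ℂ A A] [SMulCommClass ℂ A A] [CompleteSpace A]
    (hA : ¬ FiniteDimensional ℂ A) :
    {M : Submodule ℂ A | IsMaxNonFG M} = {M : Submodule ℂ A | IsMaxNonCG M} ∧
    {M : Submodule ℂ A | IsMaxNonFG M}.Nonempty ∧
    ∀ M : Submodule ℂ A, IsMaxNonFG M → IsClosed (M : Set A) := by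
  have hclosed : ∀ M : Submodule ℂ A, IsMaxNonFG M → IsClosed (M : Set A) := by
    rintro M ⟨hM, hMfg, hmax⟩
    have h1 : ¬ IsFGLeftIdeal M.topologicalClosure := fun h =>
      hMfg (closed_fg_of_closure_cg hM h.isCG).2
    have h2 := hmax _ (closure_isLeftIdeal hM) h1 M.le_topologicalClosure
    rw [← h2]
    exact M.isClosed_topologicalClosure
  refine ⟨?_, ?_, hclosed⟩
  · ext M
    constructor
    · intro hM
      have hcl := hclosed M hM
      obtain ⟨hMl, hMfg, hmax⟩ := hM
      refine ⟨hMl, fun h => ?_, fun J hJ hJcg hMJ => hmax J hJ (fun h => hJcg h.isCG) hMJ⟩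
      rw [← hcl.submodule_topologicalClosure_eq] at h
      exact hMfg (closed_fg_of_closure_cg hMl h).2
    · rintro ⟨hMl, hMcg, hmax⟩
      refine ⟨hMl, fun h => hMcg h.isCG, fun J hJ hJfg hMJ => ?_⟩
      have h1 : ¬ IsCGLeftIdeal J.topologicalClosure := fun h =>
        hJfg (closed_fg_of_closure_cg hJ h).2
      have h2 := hmax _ (closure_isLeftIdeal hJ) h1 (hMJ.trans J.le_topologicalClosure)
      exact le_antisymm (h2 ▸ J.le_topologicalClosure) hMJ
  · by_contra hne
    apply hA
    apply finite_of_allFG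
    intro I hI
    by_contra hIfg
    exact hne (exists_maxNonFG I hI hIfg)
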